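/- For every odd prime p ≥ 5 and n = 3p, there exists a set of (p−1)(p−3) = (n−3)(n−9)/9 spanning trees (in fact Hamiltonian paths) of the complete graph on n vertices such that any two distinct trees in the set share at most 3 common edges; consequently A(3p, 3p−4) ≥ (p−1)(p−3). -/

import Mathlib

/-- The tree-distance between two spanning trees on `Fin n`:
`d(T₁,T₂) = n - 1 - |E₁ ∩ E₂|`. -/
noncomputable def treeDist {n : ℕ} (G H : SimpleGraph (Fin n)) : ℕ :=
  n - 1 - (G.edgeSet ∩ H.edgeSet).ncard

/-- An `(n,d)` tree-code: a finite set of (spanning) trees on `Fin n`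
such that any two distinct members have tree-distance at least `d`. -/
def IsTreeCode (n d : ℕ) (C : Finset (SimpleGraph (Fin n))) : Prop :=
  (∀ G ∈ C, G.IsTree) ∧ ∀ G ∈ C, ∀ H ∈ C, G ≠ H → d ≤ treeDist G H

/-- `A n d`: the maximum size of an `(n,d)` tree-code. -/
noncomputable def A (n d : ℕ) : ℕ :=
  sSup {m : ℕ | ∃ C : Finset (SimpleGraph (Fin n)), IsTreeCode n d C ∧ C.card = m}

/-- An `(n,d;i)` tree-code: an `(n,d)` tree-code all of whose trees contain
a common set of at least `i` edges. -/
def IsTreeCodeCommon (n d i : ℕ) (C : Finset (SimpleGraph (Fin n))) : Prop :=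
  IsTreeCode n d C ∧
    ∃ E : Finset (Sym2 (Fin n)), i ≤ E.card ∧ ∀ G ∈ C, (E : Set (Sym2 (Fin n))) ⊆ G.edgeSet

/-- `Acommon n d i`: the maximum size of an `(n,d;i)` tree-code. -/
noncomputable def Acommon (n d i : ℕ) : ℕ :=
  sSup {m : ℕ | ∃ C : Finset (SimpleGraph (Fin n)), IsTreeCodeCommon n d i C ∧ C.card = m}

namespace SimpleGraph

theorem isTree_pathGraph (n : ℕ) : (pathGraph (n + 1)).IsTree := by
  refine isTree_iff_connected_and_card.2 ⟨pathGraph_connected n, ?_⟩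
  let f : Fin n → (pathGraph (n + 1)).edgeSet := fun k ↦
    ⟨s(k.castSucc, k.succ), by simp [pathGraph_adj]⟩
  have hf : Function.Bijective f := by
    constructor
    · intro k l h
      simp only [f, Subtype.mk.injEq, Sym2.eq_iff, Fin.ext_iff, Fin.val_castSucc,
        Fin.val_succ] at h
      exact Fin.ext (by omega)
    · rintro ⟨e, he⟩
      induction e with
      | _ x y =>
        rw [mem_edgeSet, pathGraph_adj] at he
        rcases he with h | h
        · refine ⟨⟨x, by omega⟩, Subtype.ext (Sym2.eq_iff.2 (Or.inl ?_))⟩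
          simp [h]
        · refine ⟨⟨y, by omega⟩, Subtype.ext (Sym2.eq_iff.2 (Or.inr ?_))⟩
          simp [h]
  rw [← Nat.card_eq_of_bijective f hf]
  simp

theorem exists_isHamiltonian_pathGraph (n : ℕ) :
    ∃ (u v : Fin (n + 1)) (w : (pathGraph (n + 1)).Walk u v), w.IsHamiltonian := by
  have hne : List.finRange (n + 1) ≠ [] := by simp [List.finRange_succ]
  have hchain : (List.finRange (n + 1)).IsChain (pathGraph (n + 1)).Adj := by
    rw [List.isChain_iff_getElem]
    intro i hi
    simp [pathGraph_adj]
  refine ⟨_, _, Walk.ofSupport _ hne hchain, fun x ↦ ?_⟩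
  rw [Walk.support_ofSupport]
  exact List.count_eq_one_of_mem (List.nodup_finRange _) (List.mem_finRange x)

/-- A graph is a *spanning path* when it is a tree with a Hamiltonian walk. -/
def IsSpanningPath {V : Type*} [DecidableEq V] (G : SimpleGraph V) : Prop :=
  G.IsTree ∧ ∃ (u v : V) (w : G.Walk u v), w.IsHamiltonian

theorem isSpanningPath_pathGraph (n : ℕ) : (pathGraph (n + 1)).IsSpanningPath :=
  ⟨isTree_pathGraph n, exists_isHamiltonian_pathGraph n⟩

theorem IsSpanningPath.map {V W : Type*} [DecidableEq V] [DecidableEq W] {G : SimpleGraph V}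
    (hG : G.IsSpanningPath) (e : V ≃ W) : (G.map e.toEmbedding).IsSpanningPath := by
  obtain ⟨ht, u, v, w, hw⟩ := hG
  let φ : G ≃g G.map e.toEmbedding := Iso.map e G
  exact ⟨φ.isTree_iff.1 ht, _, _, w.map φ.toHom, hw.map φ.toHom φ.bijective⟩

end SimpleGraph

open SimpleGraph

section Construction

variable {p : ℕ}

/-- The `k`-th vertex of the zigzag path with parameters `u` and `a`, which visits the three
copies of `ZMod p` cyclically. -/
def zigzagVertex (u a : ZMod p) (k : ℕ) : Fin 3 × ZMod p :=
  match k % 3 with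
  | 0 => (0, (k / 3 : ℕ) * u)
  | 1 => (1, ((k / 3 : ℕ) + 1) * (a * u))
  | _ => (2, (k / 3 : ℕ) + 1 + a)

/-- A set containing all edges of the zigzag path with parameters `u` and `a`. -/
def zigzagEdges (u a : ZMod p) : Set (Sym2 (Fin 3 × ZMod p)) :=
  {e | ∃ i : ZMod p, e = s((0, i * u), (1, (i + 1) * (a * u))) ∨
    e = s((1, i * (a * u)), (2, i + a)) ∨ e = s((2, i + a), (0, i * u))}

theorem zigzagVertex_three_mul (u a : ZMod p) (i : ℕ) :
    zigzagVertex u a (3 * i) = (0, i * u) := by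
  have h : 3 * i % 3 = 0 := by omega
  simp [zigzagVertex, h]

theorem zigzagVertex_three_mul_add_one (u a : ZMod p) (i : ℕ) :
    zigzagVertex u a (3 * i + 1) = (1, (i + 1) * (a * u)) := by
  have h : (3 * i + 1) % 3 = 1 := by omega
  have h' : (3 * i + 1) / 3 = i := by omega
  simp [zigzagVertex, h, h']

theorem zigzagVertex_three_mul_add_two (u a : ZMod p) (i : ℕ) :
    zigzagVertex u a (3 * i + 2) = (2, i + 1 + a) := by
  have h : (3 * i + 2) % 3 = 2 := by omega
  have h' : (3 * i + 2) / 3 = i := by omega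
  simp [zigzagVertex, h, h']

theorem exists_eq_three_mul_add (k : ℕ) : ∃ i, k = 3 * i ∨ k = 3 * i + 1 ∨ k = 3 * i + 2 :=
  ⟨k / 3, by omega⟩

theorem zigzagVertex_succ_mem (u a : ZMod p) (k : ℕ) :
    s(zigzagVertex u a k, zigzagVertex u a (k + 1)) ∈ zigzagEdges u a := by
  obtain ⟨i, rfl | rfl | rfl⟩ := exists_eq_three_mul_add k
  · rw [zigzagVertex_three_mul, zigzagVertex_three_mul_add_one]
    exact ⟨i, Or.inl rfl⟩
  · rw [zigzagVertex_three_mul_add_one, zigzagVertex_three_mul_add_two]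
    exact ⟨i + 1, Or.inr (Or.inl rfl)⟩
  · rw [zigzagVertex_three_mul_add_two, show 3 * i + 2 + 1 = 3 * (i + 1) by ring,
      zigzagVertex_three_mul]
    exact ⟨i + 1, Or.inr (Or.inr (by push_cast; rfl))⟩

variable [Fact p.Prime]

theorem zigzagVertex_injOn {u a : ZMod p} (hu : u ≠ 0) (ha : a ≠ 0) :
    Set.InjOn (zigzagVertex u a) (Set.Iio (3 * p)) := by
  have hcast {i j : ℕ} (hi : i < p) (hj : j < p) (h : (i : ZMod p) = j) : i = j := by
    rw [ZMod.natCast_eq_natCast_iff'] at h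
    rwa [Nat.mod_eq_of_lt hi, Nat.mod_eq_of_lt hj] at h
  intro k hk l hl h
  rw [Set.mem_Iio] at hk hl
  obtain ⟨i, hi⟩ := exists_eq_three_mul_add k
  obtain ⟨j, hj⟩ := exists_eq_three_mul_add l
  have key := hcast (i := i) (j := j) (by omega) (by omega)
  rcases hi with rfl | rfl | rfl <;> rcases hj with rfl | rfl | rfl <;>
    simp [zigzagVertex_three_mul, zigzagVertex_three_mul_add_one,
      zigzagVertex_three_mul_add_two, hu, ha] at h <;>
    rw [key h]

theorem injOn_zigzagEdges_inter {u a u' a' : ZMod p} (hu : u ≠ 0) (ha : a ≠ 0)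
    (hne : (u, a) ≠ (u', a')) :
    Set.InjOn (Sym2.map Prod.fst) (zigzagEdges u a ∩ zigzagEdges u' a') := by
  have h01 {i i' j j' : ZMod p} (h₁ : i * u = i' * u') (h₂ : j * u = j' * u')
      (h₃ : (i + 1) * (a * u) = (i' + 1) * (a' * u'))
      (h₄ : (j + 1) * (a * u) = (j' + 1) * (a' * u')) : i = j := by
    by_contra hij
    have haa : a = a' := by
      refine mul_left_cancel₀ (mul_ne_zero (sub_ne_zero.2 hij) hu) ?_
      linear_combination h₃ - h₄ - a' * (h₁ - h₂)
    subst haa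
    have huu : u = u' := by
      refine mul_left_cancel₀ ha ?_
      linear_combination h₃ - a * h₁
    exact hne (by rw [huu])
  have h12 {i i' j j' : ZMod p} (h₁ : i * (a * u) = i' * (a' * u'))
      (h₂ : j * (a * u) = j' * (a' * u')) (h₃ : i + a = i' + a') (h₄ : j + a = j' + a') :
      i = j := by
    by_contra hij
    have hau : a * u = a' * u' := by
      refine mul_left_cancel₀ (sub_ne_zero.2 hij) ?_
      linear_combination h₁ - h₂ - a' * u' * (h₃ - h₄)
    have hii (k k' : ZMod p) (h : k * (a * u) = k' * (a' * u')) : k = k' :=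
      mul_right_cancel₀ (mul_ne_zero ha hu) (h.trans (by rw [hau]))
    have haa : a = a' := by
      linear_combination h₃ - hii i i' h₁
    subst haa
    exact hne (by rw [mul_left_cancel₀ ha hau])
  have h20 {i i' j j' : ZMod p} (h₁ : i + a = i' + a') (h₂ : j + a = j' + a')
      (h₃ : i * u = i' * u') (h₄ : j * u = j' * u') : i = j := by
    by_contra hij
    have huu : u = u' := by
      refine mul_left_cancel₀ (sub_ne_zero.2 hij) ?_
      linear_combination h₃ - h₄ - u' * (h₁ - h₂)
    subst huu
    have hii : i = i' := mul_right_cancel₀ hu h₃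
    exact hne (by rw [show a = a' by linear_combination h₁ - hii])
  rintro e ⟨⟨i, he⟩, ⟨i', he'⟩⟩ f ⟨⟨j, hf⟩, ⟨j', hf'⟩⟩ hef
  rcases he with rfl | rfl | rfl <;> rcases hf with rfl | rfl | rfl <;>
    simp at hef <;> simp at he' hf'
  · rw [h01 he'.1 hf'.1 he'.2 hf'.2]
  · rw [h12 he'.1 hf'.1 he'.2 hf'.2]
  · rw [h20 he'.1 hf'.1 he'.2 hf'.2]

theorem ncard_zigzagEdges_inter_le {u a u' a' : ZMod p} (hu : u ≠ 0) (ha : a ≠ 0)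
    (hne : (u, a) ≠ (u', a')) : (zigzagEdges u a ∩ zigzagEdges u' a').ncard ≤ 3 := by
  let T : Finset (Sym2 (Fin 3)) := {s(0, 1), s(1, 2), s(2, 0)}
  have hT : (T : Set (Sym2 (Fin 3))).ncard ≤ 3 := by
    rw [Set.ncard_coe_finset]
    exact Finset.card_le_three
  refine (Set.ncard_le_ncard_of_injOn _ ?_ (injOn_zigzagEdges_inter hu ha hne)
    T.finite_toSet).trans hT
  rintro e ⟨⟨i, rfl | rfl | rfl⟩, -⟩ <;> simp [T]

/-- The zigzag path with parameters `u` and `a`, as a graph. -/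
def zigzagGraph (u a : (ZMod p)ˣ) : SimpleGraph (Fin 3 × ZMod p) :=
  (pathGraph (3 * p)).map fun k : Fin (3 * p) ↦ zigzagVertex (u : ZMod p) a k

theorem zigzagVertex_bijective (u a : (ZMod p)ˣ) :
    Function.Bijective fun k : Fin (3 * p) ↦ zigzagVertex (u : ZMod p) a k := by
  refine (Fintype.bijective_iff_injective_and_card _).2 ⟨fun k l h ↦ Fin.ext ?_, ?_⟩
  · exact zigzagVertex_injOn u.ne_zero a.ne_zero k.2 l.2 h
  · simp [ZMod.card]

theorem isSpanningPath_zigzagGraph (u a : (ZMod p)ˣ) : (zigzagGraph u a).IsSpanningPath := by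
  have hpos : 0 < p := (Fact.out : p.Prime).pos
  have h : (pathGraph (3 * p)).IsSpanningPath := by
    obtain ⟨m, hm⟩ : ∃ m, 3 * p = m + 1 := ⟨3 * p - 1, by omega⟩
    rw [hm]
    exact isSpanningPath_pathGraph m
  exact h.map (Equiv.ofBijective _ (zigzagVertex_bijective u a))

theorem edgeSet_zigzagGraph_subset (u a : (ZMod p)ˣ) :
    (zigzagGraph u a).edgeSet ⊆ zigzagEdges (u : ZMod p) a := by
  intro e he
  induction e with
  | _ x y =>
    rw [mem_edgeSet, zigzagGraph] at he
    obtain ⟨-, k, l, hkl, rfl, rfl⟩ := he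
    beta_reduce
    rcases pathGraph_adj.1 hkl with h | h
    · rw [← h]
      exact zigzagVertex_succ_mem _ _ _
    · rw [← h, Sym2.eq_swap]
      exact zigzagVertex_succ_mem _ _ _

theorem ncard_edgeSet_zigzagGraph_inter_le {s t : (ZMod p)ˣ × (ZMod p)ˣ} (hst : s ≠ t) :
    ((zigzagGraph s.1 s.2).edgeSet ∩ (zigzagGraph t.1 t.2).edgeSet).ncard ≤ 3 := by
  refine (Set.ncard_le_ncard (Set.inter_subset_inter (edgeSet_zigzagGraph_subset _ _)
    (edgeSet_zigzagGraph_subset _ _)) (Set.toFinite _)).trans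
    (ncard_zigzagEdges_inter_le s.1.ne_zero s.2.ne_zero fun h ↦ hst ?_)
  rw [Prod.mk.injEq, Units.val_inj, Units.val_inj] at h
  exact Prod.ext h.1 h.2

theorem exists_spanningPaths_ncard_inter_le (hp : 2 ≤ p) :
    ∃ C : Finset (SimpleGraph (Fin (3 * p))), (∀ G ∈ C, G.IsSpanningPath) ∧
      (∀ G ∈ C, ∀ H ∈ C, G ≠ H → (G.edgeSet ∩ H.edgeSet).ncard ≤ 3) ∧
      C.card = (p - 1) * (p - 1) := by
  classical
  let e : Fin 3 × ZMod p ≃ Fin (3 * p) := Fintype.equivOfCardEq (by simp [ZMod.card])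
  let g : (ZMod p)ˣ × (ZMod p)ˣ → SimpleGraph (Fin (3 * p)) := fun s ↦
    (zigzagGraph s.1 s.2).map e.toEmbedding
  have hpath (s) : (g s).IsSpanningPath := (isSpanningPath_zigzagGraph s.1 s.2).map e
  have hinter {s t} (hst : s ≠ t) : ((g s).edgeSet ∩ (g t).edgeSet).ncard ≤ 3 := by
    simp only [g, edgeSet_map]
    rw [← Set.image_inter (Function.Embedding.injective _),
      Set.ncard_image_of_injective _ (Function.Embedding.injective _)]
    exact ncard_edgeSet_zigzagGraph_inter_le hst
  have hinj : Function.Injective g := by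
    intro s t h
    by_contra hst
    have h₁ := hinter hst
    have h₂ := (isTree_iff_connected_and_card.1 (hpath s).1).2
    rw [← h, Set.inter_self, ← Nat.card_coe_set_eq] at h₁
    rw [Nat.card_eq_fintype_card (α := Fin (3 * p)), Fintype.card_fin] at h₂
    omega
  refine ⟨Finset.univ.image g, ?_, ?_, ?_⟩
  · simp only [Finset.mem_image, Finset.mem_univ, true_and]
    rintro _ ⟨s, rfl⟩
    exact hpath s
  · simp only [Finset.mem_image, Finset.mem_univ, true_and]
    rintro _ ⟨s, rfl⟩ _ ⟨t, rfl⟩ hne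
    exact hinter fun h ↦ hne (congrArg g h)
  · rw [Finset.card_image_of_injective _ hinj]
    simp [ZMod.card_units_eq_totient, Nat.totient_prime Fact.out]

end Construction

theorem IsTreeCode.card_le_A {n d : ℕ} {C : Finset (SimpleGraph (Fin n))}
    (hC : IsTreeCode n d C) : C.card ≤ A n d := by
  classical
  refine le_csSup ⟨Fintype.card (SimpleGraph (Fin n)), ?_⟩ ⟨C, hC, rfl⟩
  rintro _ ⟨D, -, rfl⟩
  exact Finset.card_le_univ D

theorem stmt18 (p : ℕ) (hp : p.Prime) (hp5 : 5 ≤ p) :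
    (∃ C : Finset (SimpleGraph (Fin (3 * p))),
        (∀ G ∈ C, G.IsTree ∧ ∃ (u v : Fin (3 * p)) (w : G.Walk u v), w.IsHamiltonian) ∧
        (∀ G ∈ C, ∀ H ∈ C, G ≠ H → (G.edgeSet ∩ H.edgeSet).ncard ≤ 3) ∧
        C.card = (p - 1) * (p - 3)) ∧
      (p - 1) * (p - 3) ≤ A (3 * p) (3 * p - 4) := by
  have : Fact p.Prime := ⟨hp⟩
  obtain ⟨D, hpath, hinter, hD⟩ := exists_spanningPaths_ncard_inter_le (p := p) (by omega)
  obtain ⟨C, hCD, hC⟩ : ∃ C ⊆ D, C.card = (p - 1) * (p - 3) :=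
    Finset.exists_subset_card_eq (hD ▸ Nat.mul_le_mul_left _ (by omega))
  have hinter' : ∀ G ∈ C, ∀ H ∈ C, G ≠ H → (G.edgeSet ∩ H.edgeSet).ncard ≤ 3 :=
    fun G hG H hH ↦ hinter G (hCD hG) H (hCD hH)
  refine ⟨⟨C, fun G hG ↦ hpath G (hCD hG), hinter', hC⟩, ?_⟩
  rw [← hC]
  refine IsTreeCode.card_le_A ⟨fun G hG ↦ (hpath G (hCD hG)).1, fun G hG H hH hne ↦ ?_⟩
  have := hinter' G hG H hH hne
  unfold treeDist
  omega
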